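/- arXiv:math/0205053 — 3 statements merged into one kernel-verified Lean document; each statement's English description precedes it below -/
import Mathlib

section
/- Let R be a commutative ring and p ∈ R[X] a monic polynomial whose constant coefficient is a unit of R. Then there is a ring isomorphism between the quotient R[X] ⧸ (p) and the quotient of the Laurent polynomial ring R[T,T⁻¹] by the ideal generated by the image of p under the canonical inclusion R[X] → R[T,T⁻¹] (sending X to T). -/
open Polynomial

/-- Localizing at elements that are already units modulo `I` does not change the quotient. -/
noncomputable def quotientEquivQuotientMapOfIsUnit {A : Type*} (S : Type*) [CommRing A] [CommRing S]
    [Algebra A S] (M : Submonoid A) [IsLocalization M S] (I : Ideal A)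
    (hM : ∀ m ∈ M, IsUnit (Ideal.Quotient.mk I m)) :
    (A ⧸ I) ≃+* (S ⧸ I.map (algebraMap A S)) :=
  (IsLocalization.atUnits (A ⧸ I) (Algebra.algebraMapSubmonoid (A ⧸ I) M)
    (S := S ⧸ I.map (algebraMap A S)) (by rintro _ ⟨m, hm, rfl⟩; exact hM m hm)).toRingEquiv

/-- If the constant coefficient of `p` is a unit, then `X` is a unit modulo `p`. -/
theorem isUnit_quotient_mk_X {R : Type*} [CommRing R] {p : R[X]} (h0 : IsUnit (p.coeff 0)) :
    IsUnit (Ideal.Quotient.mk (Ideal.span {p}) X) := by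
  have hp : Ideal.Quotient.mk (Ideal.span {p}) (p.divX * X + C (p.coeff 0)) = 0 := by
    rw [divX_mul_X_add]
    exact Ideal.Quotient.eq_zero_iff_mem.2 (Ideal.mem_span_singleton_self p)
  rw [map_add, map_mul] at hp
  have hu := (h0.map C).map (Ideal.Quotient.mk (Ideal.span {p}))
  rw [eq_neg_of_add_eq_zero_right hp] at hu
  exact isUnit_of_mul_isUnit_right ((IsUnit.neg_iff _).1 hu)

/-- If `p` is a monic polynomial over a commutative ring `R` whose constant coefficient
is a unit, then `R[X] ⧸ (p)` is ring-isomorphic to the quotient of the Laurent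
polynomial ring `R[T,T⁻¹]` by the ideal generated by the image of `p` under the
canonical inclusion `R[X] → R[T,T⁻¹]` (sending `X` to `T`). -/
theorem polynomial_quotient_iso_laurent_quotient
    (R : Type*) [CommRing R] (p : R[X]) (hp : p.Monic) (h0 : IsUnit (p.coeff 0)) :
    Nonempty ((R[X] ⧸ Ideal.span {p}) ≃+*
      (LaurentPolynomial R ⧸ Ideal.span {Polynomial.toLaurent (R := R) p})) := by
  have e := quotientEquivQuotientMapOfIsUnit (LaurentPolynomial R)
    (Submonoid.powers (X : R[X])) (Ideal.span {p}) (by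
      rintro _ ⟨n, rfl⟩
      simpa only [map_pow] using (isUnit_quotient_mk_X h0).pow n)
  rw [Ideal.map_span, Set.image_singleton, LaurentPolynomial.algebraMap_eq_toLaurent] at e
  exact ⟨e⟩
end

section
/- Let n be a positive integer and h ∈ (ZMod n)[X] a monic polynomial whose constant coefficient is a unit of ZMod n. Then the quotient of the Laurent polynomial ring (ZMod n)[T,T⁻¹] by the ideal generated by the image of h (under the canonical inclusion sending X to T) is a finite ring. -/
open Polynomial

/-- If the constant coefficient of `h` is a unit, then `R[X]` surjects onto the quotient of
`R[T;T⁻¹]` by the ideal generated by `h`. -/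
theorem surjective_mk_comp_toLaurent {R : Type*} [CommRing R] {h : R[X]}
    (h0 : IsUnit (h.coeff 0)) :
    Function.Surjective
      ((Ideal.Quotient.mk (Ideal.span {Polynomial.toLaurent h})).comp
        (Polynomial.toLaurent (R := R))) := by
  set I := Ideal.span {Polynomial.toLaurent h}
  set φ := (Ideal.Quotient.mk I).comp (Polynomial.toLaurent (R := R)) with hφ
  obtain ⟨u, hu⟩ := h0.exists_right_inv
  have hh : φ h = 0 := Ideal.Quotient.eq_zero_iff_mem.2 (Ideal.mem_span_singleton_self _)
  obtain ⟨g, hg⟩ : ∃ g : R[X], φ X * φ g = 1 := by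
    refine ⟨-(Polynomial.C u * h.divX), ?_⟩
    have key : X * -(Polynomial.C u * h.divX) = 1 - Polynomial.C u * h := by
      have hC : Polynomial.C (h.coeff 0) * Polynomial.C u = 1 := by
        rw [← Polynomial.C_mul, hu, Polynomial.C_1]
      linear_combination hC - Polynomial.C u * h.divX_mul_X_add
    rw [← map_mul, key, map_sub, map_mul, hh, map_one, mul_zero, sub_zero]
  intro q
  obtain ⟨f, rfl⟩ := Ideal.Quotient.mk_surjective q
  obtain ⟨n, p, hp⟩ := f.exists_T_pow
  refine ⟨p * g ^ n, ?_⟩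
  have hpφ : φ p = Ideal.Quotient.mk I f * φ X ^ n := by
    rw [← map_pow, hφ, RingHom.comp_apply, RingHom.comp_apply, hp, Polynomial.toLaurent_X_pow,
      map_mul]
  rw [map_mul, map_pow, hpφ, mul_assoc, ← mul_pow, hg, one_pow, mul_one]

/-- For `n` positive and `h ∈ (ZMod n)[X]` monic with unit constant coefficient, the
quotient of the Laurent polynomial ring `(ZMod n)[T,T⁻¹]` by the ideal generated by
the image of `h` (under the inclusion sending `X` to `T`) is a finite ring. -/
theorem laurent_quotient_finite (n : ℕ) (hn : 0 < n) (h : (ZMod n)[X])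
    (hm : h.Monic) (h0 : IsUnit (h.coeff 0)) :
    Finite (LaurentPolynomial (ZMod n) ⧸
      Ideal.span {Polynomial.toLaurent (R := ZMod n) h}) := by
  have : NeZero n := ⟨hn.ne'⟩
  have := hm.finite_quotient
  have : Finite ((ZMod n)[X] ⧸ Ideal.span {h}) := Module.finite_of_finite (ZMod n)
  refine Finite.of_surjective (Ideal.quotientMap (I := Ideal.span {h}) _ Polynomial.toLaurent ?_)
    (Function.Surjective.of_comp (g := Ideal.Quotient.mk (Ideal.span {h})) ?_)
  · rw [Ideal.span_singleton_le_iff_mem]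
    exact Ideal.mem_span_singleton_self _
  · exact surjective_mk_comp_toLaurent h0
end

section
/- Let n be a positive integer and h ∈ (ZMod n)[X] a monic polynomial of degree d whose constant coefficient is a unit of ZMod n. Then the quotient of the Laurent polynomial ring (ZMod n)[T,T⁻¹] by the ideal generated by the image of h has exactly n^d elements. -/
open Polynomial

section LaurentQuotient

variable {R : Type*} [CommRing R]

theorem isCoprime_X_pow_of_isUnit_coeff_zero {f : R[X]} (h0 : IsUnit (f.coeff 0)) (k : ℕ) :
    IsCoprime f (X ^ k) := by
  apply IsCoprime.pow_right
  obtain ⟨b, hb⟩ := h0.exists_left_inv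
  refine ⟨C b, -(C b * f.divX), ?_⟩
  have hC : C b * C (f.coeff 0) = 1 := by rw [← C_mul, hb, C_1]
  linear_combination hC - C b * f.divX_mul_X_add

theorem toLaurent_dvd_toLaurent_iff {f p : R[X]} (h0 : IsUnit (f.coeff 0)) :
    toLaurent f ∣ toLaurent p ↔ f ∣ p := by
  refine ⟨?_, map_dvd toLaurent⟩
  rintro ⟨y, hy⟩
  obtain ⟨k, g, hg⟩ := LaurentPolynomial.exists_T_pow y
  refine (isCoprime_X_pow_of_isUnit_coeff_zero h0 k).dvd_of_dvd_mul_right (y := p) ⟨g, ?_⟩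
  apply toLaurent_injective
  rw [map_mul, map_mul, hg, hy, toLaurent_X_pow, mul_assoc]

theorem exists_toLaurent_dvd_sub {f : R[X]} (h0 : IsUnit (f.coeff 0)) (y : LaurentPolynomial R) :
    ∃ p : R[X], toLaurent f ∣ toLaurent p - y := by
  obtain ⟨k, g, hg⟩ := LaurentPolynomial.exists_T_pow y
  obtain ⟨a, b, hab⟩ := isCoprime_X_pow_of_isUnit_coeff_zero h0 k
  refine ⟨b * g, -(y * toLaurent a), ?_⟩
  have hL := congrArg toLaurent hab
  simp only [map_add, map_mul, toLaurent_X_pow, map_one] at hL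
  rw [map_mul, hg]
  linear_combination y * hL

/-- Inverting `X` does not change the quotient by a polynomial with unit constant coefficient. -/
noncomputable def adjoinRootEquivLaurentQuotient {f : R[X]} (h0 : IsUnit (f.coeff 0)) :
    AdjoinRoot f ≃+* LaurentPolynomial R ⧸ Ideal.span {toLaurent f} :=
  let φ := (Ideal.Quotient.mk (Ideal.span {toLaurent f})).comp (toLaurent (R := R))
  have hker : Ideal.span {f} = RingHom.ker φ := by
    ext p
    rw [RingHom.mem_ker, RingHom.comp_apply, Ideal.Quotient.eq_zero_iff_mem,
      Ideal.mem_span_singleton, Ideal.mem_span_singleton, toLaurent_dvd_toLaurent_iff h0]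
  have hsurj : Function.Surjective φ := by
    intro z
    obtain ⟨y, rfl⟩ := Ideal.Quotient.mk_surjective z
    obtain ⟨p, hp⟩ := exists_toLaurent_dvd_sub h0 y
    exact ⟨p, Ideal.Quotient.eq.2 (Ideal.mem_span_singleton.2 hp)⟩
  (Ideal.quotEquivOfEq hker).trans (RingHom.quotientKerEquivOfSurjective hsurj)

theorem natCard_adjoinRoot_of_monic {f : R[X]} (hf : f.Monic) :
    Nat.card (AdjoinRoot f) = Nat.card R ^ f.natDegree := by
  rw [Nat.card_congr (AdjoinRoot.powerBasis' hf).basis.equivFun.toEquiv, Nat.card_fun,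
    Nat.card_fin, AdjoinRoot.powerBasis'_dim]

end LaurentQuotient

/-- For `n` positive and `h ∈ (ZMod n)[X]` monic of degree `d` with unit constant
coefficient, the quotient of `(ZMod n)[T,T⁻¹]` by the ideal generated by the image of
`h` has exactly `n ^ d` elements. -/
theorem laurent_quotient_card (n : ℕ) (hn : 0 < n) (h : (ZMod n)[X]) (d : ℕ)
    (hm : h.Monic) (hd : h.natDegree = d) (h0 : IsUnit (h.coeff 0)) :
    Nat.card (LaurentPolynomial (ZMod n) ⧸
      Ideal.span {Polynomial.toLaurent (R := ZMod n) h}) = n ^ d := by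
  rw [← Nat.card_congr (adjoinRootEquivLaurentQuotient h0).toEquiv,
    natCard_adjoinRoot_of_monic hm, Nat.card_zmod, hd]
end
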